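/- (Theorem 2.4, second mapping of (2.4).) Let α > 0 and assume either m ≥ 0, or m < 0 and θ < α. Then there exist a ≥ 0 and a Borel measure μ on (0,∞) with ∫₀^∞ min(1,r) μ(dr) < ∞ such that for all q ≥ 0: (1/I_{α,ψ}(q))·exp( −q·I'_{α,ψ}(q)/I_{α,ψ}(q) ) = exp( −( a·q + ∫₀^∞ (1 − e^{−q·r}) μ(dr) ) ). In other words, this mapping is the Laplace transform of an infinitely divisible probability distribution on [0,∞). -/

import Mathlib

open MeasureTheory Real Set Filter Topology

/-- The Laplace exponent of a spectrally negative infinitely divisible random variable. -/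
noncomputable def psi (σ b : ℝ) (ν : Measure ℝ) (u : ℝ) : ℝ :=
  b * u + σ / 2 * u ^ 2 +
    ∫ r in Ioi (0 : ℝ), (Real.exp (-u * r) - 1 + (if r ≤ 1 then u * r else 0)) ∂ν

/-- The coefficients `a_n(ψ;α) = (∏_{k=1}^n ψ(αk))⁻¹`, with `a_0 = 1`. -/
noncomputable def coeffA (ψ : ℝ → ℝ) (α : ℝ) (n : ℕ) : ℝ :=
  (∏ k ∈ Finset.range n, ψ (α * (k + 1)))⁻¹

/-- The power series `I_{α,ψ}(x) = Σ_{n≥0} a_n(ψ;α) x^n`. -/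
noncomputable def Iser (ψ : ℝ → ℝ) (α : ℝ) (x : ℝ) : ℝ :=
  ∑' n : ℕ, coeffA ψ α n * x ^ n

/-- The power functions `q ↦ x ^ q` with `x ∈ [0, 1]`, as a multiplicative monoid. -/
noncomputable def powMonoid : Submonoid (NNReal → ℝ) where
  carrier := {f | ∃ x : ℝ, 0 ≤ x ∧ x ≤ 1 ∧ f = fun q : NNReal => x ^ (q : ℝ)}
  mul_mem' := by
    rintro _ _ ⟨x, hx0, hx1, rfl⟩ ⟨y, hy0, hy1, rfl⟩
    refine ⟨x * y, by positivity, mul_le_one₀ hx1 hy0 hy1, ?_⟩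
    ext q
    simp [Real.mul_rpow hx0 hy0]
  one_mem' := ⟨1, by norm_num, le_rfl, by ext q; simp⟩

/-- Pointwise limits of nonnegative combinations of the functions `q ↦ x ^ q`, `x ∈ [0, 1]`. -/
noncomputable def complMono : Subalgebra NNReal (NNReal → ℝ) :=
  (Algebra.adjoin NNReal (powMonoid : Set (NNReal → ℝ))).topologicalClosure

lemma complMono_isClosed : IsClosed (complMono : Set (NNReal → ℝ)) :=
  Subalgebra.isClosed_topologicalClosure _

lemma rpow_mem_complMono {x : ℝ} (hx0 : 0 ≤ x) (hx1 : x ≤ 1) :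
    (fun q : NNReal => x ^ (q : ℝ)) ∈ complMono :=
  Subalgebra.le_topologicalClosure _ (Algebra.subset_adjoin ⟨x, hx0, hx1, rfl⟩)

lemma const_mul_mem_complMono {c : ℝ} (hc : 0 ≤ c) {S : NNReal → ℝ} (hS : S ∈ complMono) :
    (fun q => c * S q) ∈ complMono := by
  have := complMono.smul_mem hS (⟨c, hc⟩ : NNReal)
  convert this using 1
  rfl

lemma inv_sub_mem_complMono {S : NNReal → ℝ} (hS : S ∈ complMono) {A : ℝ}
    (h0 : ∀ q, 0 ≤ S q) (hA : ∀ q, S q < A) : (fun q => (A - S q)⁻¹) ∈ complMono := by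
  have hApos : 0 < A := (h0 0).trans_lt (hA 0)
  refine complMono_isClosed.mem_of_tendsto (f := fun n : ℕ => fun q : NNReal =>
    ∑ k ∈ Finset.range n, (A⁻¹) ^ (k + 1) * (S q) ^ k) (b := atTop) ?_ ?_
  · rw [tendsto_pi_nhds]
    intro q
    have hr : S q / A < 1 := (div_lt_one hApos).2 (hA q)
    have := ((hasSum_geometric_of_lt_one (div_nonneg (h0 q) hApos.le) hr).mul_left
      A⁻¹).tendsto_sum_nat
    have e : A⁻¹ * (1 - S q / A)⁻¹ = (A - S q)⁻¹ := by
      rw [← mul_inv]; congr 1; field_simp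
    rw [e] at this
    refine this.congr fun n => Finset.sum_congr rfl fun k _ => ?_
    rw [div_eq_mul_inv, mul_pow]; ring
  · refine Eventually.of_forall fun n => ?_
    have : (∑ k ∈ Finset.range n, fun q => (A⁻¹) ^ (k + 1) * (S q) ^ k) ∈ complMono :=
      Subalgebra.sum_mem _ fun k _ => const_mul_mem_complMono (by positivity)
        (complMono.pow_mem hS k)
    rw [SetLike.mem_coe]
    convert this using 1
    ext q; simp

lemma tendsto_nat_mul_one_sub_exp (x : ℝ) :
    Tendsto (fun n : ℕ => ((n : ℝ) + 1) * (1 - Real.exp (-(x / (n + 1))))) atTop (𝓝 x) := by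
  have hd : HasDerivAt (fun y : ℝ => 1 - Real.exp (-(x * y))) x 0 := by
    have := ((((hasDerivAt_id (0 : ℝ)).const_mul x).neg).exp).const_sub 1
    simpa using this
  have := hd.tendsto_slope_zero_right
  have h2 : Tendsto (fun n : ℕ => (1 : ℝ) / ((n : ℝ) + 1)) atTop (𝓝[>] 0) :=
    tendsto_nhdsWithin_iff.2 ⟨tendsto_one_div_add_atTop_nhds_zero_nat,
      Eventually.of_forall fun n => by simp only [mem_Ioi]; positivity⟩
  refine (this.comp h2).congr fun n => ?_
  simp [div_eq_mul_inv]

lemma inv_linear_sub_mem_complMono {S : NNReal → ℝ} (hS : S ∈ complMono) {A ε : ℝ}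
    (hε : 0 ≤ ε) (h0 : ∀ q, 0 ≤ S q) (hA : ∀ q, S q < A) :
    (fun q : NNReal => (ε * q + A - S q)⁻¹) ∈ complMono := by
  refine complMono_isClosed.mem_of_tendsto (f := fun n : ℕ => fun q : NNReal =>
    (((n : ℝ) + 1 + A) - (((n : ℝ) + 1) * Real.exp (-(ε / (n + 1))) ^ (q : ℝ) + S q))⁻¹)
    (b := atTop) ?_ ?_
  · rw [tendsto_pi_nhds]
    intro q
    have hpos : ε * q + A - S q ≠ 0 := by
      have := hA q
      have : 0 ≤ ε * q := by positivity
      linarith [hA q]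
    refine Tendsto.inv₀ ?_ hpos
    have := (tendsto_nat_mul_one_sub_exp (ε * q)).add_const (A - S q)
    rw [add_sub_assoc]
    refine this.congr fun n => ?_
    rw [← Real.exp_mul]
    have : -(ε / ((n : ℝ) + 1)) * q = -(ε * q / (n + 1)) := by ring
    rw [this]; ring
  · refine Eventually.of_forall fun n => ?_
    have he : Real.exp (-(ε / ((n : ℝ) + 1))) ≤ 1 := by
      rw [Real.exp_le_one_iff, neg_nonpos]; positivity
    refine inv_sub_mem_complMono (S := fun q : NNReal =>
      ((n : ℝ) + 1) * Real.exp (-(ε / (n + 1))) ^ (q : ℝ) + S q) ?_ ?_ ?_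
    · exact complMono.add_mem (const_mul_mem_complMono (by positivity)
        (rpow_mem_complMono (Real.exp_pos _).le he)) hS
    · intro q; have := h0 q; positivity
    · intro q
      have h1 : Real.exp (-(ε / ((n : ℝ) + 1))) ^ (q : ℝ) ≤ 1 :=
        Real.rpow_le_one (Real.exp_pos _).le he q.2
      have h2 : ((n : ℝ) + 1) * Real.exp (-(ε / ((n : ℝ) + 1))) ^ (q : ℝ) ≤ (n + 1) * 1 := by
        gcongr
      linarith [hA q]

/-- Ratios of positive eigenfunctions of an upward skip-free generator are completely monotone
in the eigenvalue. -/
lemma skipFree_ratio_mem_complMono {f : ℕ → NNReal → ℝ} {up : ℕ → ℝ} {ℓ : ℕ → ℕ → ℝ} {ε : ℝ}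
    (hε : 0 ≤ ε) (hf : ∀ n q, 0 < f n q) (hmono : ∀ q, Monotone fun n => f n q)
    (hup : ∀ n, 0 < up n) (hℓ : ∀ n j, 0 ≤ ℓ n j)
    (heq : ∀ n (q : NNReal), ε * q * f n q = up n * (f (n + 1) q - f n q) +
      ∑ j ∈ Finset.range n, ℓ n j * (f j q - f n q)) (n : ℕ) :
    ∀ j ≤ n, (fun q => f j q / f n q) ∈ complMono := by
  induction n with
  | zero =>
    intro j hj
    obtain rfl : j = 0 := by omega
    convert complMono.one_mem using 1
    ext q; simp [(hf 0 q).ne']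
  | succ n ih =>
    have key : (fun q => f n q / f (n + 1) q) ∈ complMono := by
      have hS : (fun q => ∑ j ∈ Finset.range n, ℓ n j * (f j q / f n q)) ∈ complMono := by
        have : (∑ j ∈ Finset.range n, fun q => ℓ n j * (f j q / f n q)) ∈ complMono :=
          Subalgebra.sum_mem _ fun j hj => const_mul_mem_complMono (hℓ n j)
            (ih j (Finset.mem_range.1 hj).le)
        convert this using 1
        ext q; simp
      have hle : ∀ q, ∑ j ∈ Finset.range n, ℓ n j * (f j q / f n q) ≤
          ∑ j ∈ Finset.range n, ℓ n j := fun q => Finset.sum_le_sum fun j hj =>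
        mul_le_of_le_one_right (hℓ n j)
          ((div_le_one (hf n q)).2 (hmono q (Finset.mem_range.1 hj).le))
      have := const_mul_mem_complMono (hup n).le (inv_linear_sub_mem_complMono hS
        (A := up n + ∑ j ∈ Finset.range n, ℓ n j) hε
        (fun q => Finset.sum_nonneg fun j _ =>
          mul_nonneg (hℓ n j) (div_nonneg (hf j q).le (hf n q).le))
        (fun q => by linarith [hle q, hup n]))
      convert this using 1
      ext q
      have h1 := hf n q
      have h2 := hf (n + 1) q
      have hq : 0 ≤ ε * q := by positivity
      have hpos : 0 < ε * q + (up n + ∑ j ∈ Finset.range n, ℓ n j) -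
          ∑ j ∈ Finset.range n, ℓ n j * (f j q / f n q) := by linarith [hle q, hup n]
      rw [div_eq_iff h2.ne', mul_assoc, mul_comm, ← div_eq_iff (hup n).ne', inv_mul_eq_div,
        eq_div_iff hpos.ne', div_mul_eq_mul_div, div_eq_iff (hup n).ne']
      have h3 := heq n q
      have h4 : f n q * ∑ j ∈ Finset.range n, ℓ n j * (f j q / f n q) =
          ∑ j ∈ Finset.range n, ℓ n j * f j q := by
        rw [Finset.mul_sum]
        refine Finset.sum_congr rfl fun j _ => ?_
        field_simp
      simp only [mul_sub, Finset.sum_sub_distrib, ← Finset.sum_mul] at h3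
      rw [mul_sub, h4]
      linarith
    intro j hj
    rcases Nat.lt_or_ge n j with h | h
    · obtain rfl : j = n + 1 := by omega
      convert complMono.one_mem using 1
      ext q; simp [(hf (n + 1) q).ne']
    · convert complMono.mul_mem (ih j h) key using 1
      ext q
      simp only [Pi.mul_apply]
      have := (hf n q).ne'
      field_simp

/-- The kernel `(1 - x ^ q) / (1 - x)` on the unit interval, with value `q` at `x = 1`. -/
noncomputable def bernKernel (q : NNReal) (x : unitInterval) : ℝ :=
  dslope (fun y : ℝ => y ^ (q : ℝ)) 1 x

lemma continuous_bernKernel (q : NNReal) : Continuous (bernKernel q) := by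
  have h : ContinuousOn (dslope (fun y : ℝ => y ^ (q : ℝ)) 1) (Ici 0) := by
    rw [continuousOn_dslope (Ici_mem_nhds one_pos)]
    exact ⟨(Real.continuous_rpow_const q.2).continuousOn,
      (Real.hasDerivAt_rpow_const (Or.inl one_ne_zero)).differentiableAt⟩
  exact h.comp_continuous continuous_subtype_val fun x => x.2.1

lemma one_sub_mul_bernKernel (q : NNReal) (x : unitInterval) :
    (1 - (x : ℝ)) * bernKernel q x = 1 - (x : ℝ) ^ (q : ℝ) := by
  have := sub_smul_dslope (fun y : ℝ => y ^ (q : ℝ)) 1 x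
  simp only [smul_eq_mul, Real.one_rpow] at this
  unfold bernKernel
  linarith

lemma bernKernel_one_right (q : NNReal) : bernKernel q 1 = q := by
  simp only [bernKernel, Set.Icc.coe_one, dslope_same]
  rw [(Real.hasDerivAt_rpow_const (Or.inl one_ne_zero)).deriv]
  simp

lemma bernKernel_one_left (x : unitInterval) : bernKernel 1 x = 1 := by
  by_cases hx : x = 1
  · rw [hx, bernKernel_one_right]; simp
  · have h := one_sub_mul_bernKernel 1 x
    have hx' : (1 - (x : ℝ)) ≠ 0 := fun h => hx (Subtype.ext (by simpa using (sub_eq_zero.1 h).symm))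
    simpa [hx'] using h

lemma bernKernel_nonneg (q : NNReal) (x : unitInterval) : 0 ≤ bernKernel q x := by
  by_cases hx : x = 1
  · rw [hx, bernKernel_one_right]; exact q.2
  · have h := one_sub_mul_bernKernel q x
    have hx' : 0 < 1 - (x : ℝ) := sub_pos.2 (lt_of_le_of_ne x.2.2 fun h => hx (Subtype.ext h))
    have h1 : (x : ℝ) ^ (q : ℝ) ≤ 1 := Real.rpow_le_one x.2.1 x.2.2 q.2
    by_contra hneg
    nlinarith

lemma integrable_bernKernel (q : NNReal) (ρ : FiniteMeasure unitInterval) :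
    Integrable (bernKernel q) (ρ : Measure unitInterval) :=
  (continuous_bernKernel q).integrable_of_hasCompactSupport
    (HasCompactSupport.of_compactSpace _)

/-- Functions represented by a finite measure on the unit interval through `bernKernel`. -/
def IsBern (F : NNReal → ℝ) : Prop :=
  ∃ ρ : FiniteMeasure unitInterval, ∀ q, F q = ∫ x, bernKernel q x ∂(ρ : Measure unitInterval)

lemma IsBern.zero : IsBern fun _ => 0 := ⟨0, by simp⟩

lemma IsBern.add {F G : NNReal → ℝ} (hF : IsBern F) (hG : IsBern G) :
    IsBern fun q => F q + G q := by
  obtain ⟨ρ, hρ⟩ := hF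
  obtain ⟨κ, hκ⟩ := hG
  refine ⟨ρ + κ, fun q => ?_⟩
  simp only [hρ, hκ]
  rw [FiniteMeasure.toMeasure_add, integral_add_measure (integrable_bernKernel q ρ)
    (integrable_bernKernel q κ)]

lemma IsBern.const_mul {F : NNReal → ℝ} (hF : IsBern F) {c : ℝ} (hc : 0 ≤ c) :
    IsBern fun q => c * F q := by
  obtain ⟨ρ, hρ⟩ := hF
  lift c to NNReal using hc
  refine ⟨c • ρ, fun q => ?_⟩
  simp only [hρ]
  rw [FiniteMeasure.toMeasure_smul, integral_smul_nnreal_measure]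
  rfl

lemma IsBern.sum {ι : Type*} {F : ι → NNReal → ℝ} (s : Finset ι) (h : ∀ i ∈ s, IsBern (F i)) :
    IsBern fun q => ∑ i ∈ s, F i q := by
  classical
  induction s using Finset.induction_on with
  | empty => simpa using IsBern.zero
  | insert i s hi ih =>
    simp only [Finset.sum_insert hi]
    exact (h i (Finset.mem_insert_self _ _)).add
      (ih fun j hj => h j (Finset.mem_insert_of_mem hj))

lemma isBern_one_sub_rpow (x : unitInterval) : IsBern fun q => 1 - (x : ℝ) ^ (q : ℝ) := by
  have : IsBern fun q => bernKernel q x :=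
    ⟨⟨Measure.dirac x, inferInstance⟩, fun q => by
      simp⟩
  convert this.const_mul (sub_nonneg.2 x.2.2) using 2 with q
  rw [one_sub_mul_bernKernel]

lemma isBern_iff_exists_probabilityMeasure {F : NNReal → ℝ} :
    IsBern F ↔ 0 ≤ F 1 ∧ ∃ P : ProbabilityMeasure unitInterval,
      ∀ q, F q = F 1 * ∫ x, bernKernel q x ∂(P : Measure unitInterval) := by
  constructor
  · rintro ⟨ρ, hρ⟩
    have h1 : F 1 = ρ.mass := by
      rw [hρ]
      simp only [bernKernel_one_left, integral_const, smul_eq_mul, mul_one]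
      rfl
    refine ⟨by rw [h1]; positivity, ρ.normalize, fun q => ?_⟩
    rw [h1, hρ]
    conv_lhs => rw [ρ.self_eq_mass_smul_normalize]
    rw [FiniteMeasure.toMeasure_smul, integral_smul_nnreal_measure]
    rfl
  · rintro ⟨h1, P, hP⟩
    have : IsBern fun q => ∫ x, bernKernel q x ∂(P : Measure unitInterval) :=
      ⟨P.toFiniteMeasure, fun q => rfl⟩
    convert this.const_mul h1 using 2 with q
    exact hP q

lemma isClosed_setOf_isBern : IsClosed {F : NNReal → ℝ | IsBern F} := by
  have hset : {F : NNReal → ℝ | IsBern F} = {F | 0 ≤ F 1} ∩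
      Prod.fst '' {p : (NNReal → ℝ) × ProbabilityMeasure unitInterval |
        ∀ q, p.1 q = p.1 1 * ∫ x, bernKernel q x ∂(p.2 : Measure unitInterval)} := by
    ext F
    simp [isBern_iff_exists_probabilityMeasure]
  rw [hset]
  refine (isClosed_le continuous_const (continuous_apply 1)).inter
    (isClosedMap_fst_of_compactSpace _ ?_)
  simp only [Set.ofPred_forall]
  refine isClosed_iInter fun q => isClosed_eq ((continuous_apply q).comp continuous_fst) ?_
  refine ((continuous_apply 1).comp continuous_fst).mul ?_
  exact (ProbabilityMeasure.continuous_integral_continuousMap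
    (⟨bernKernel q, continuous_bernKernel q⟩ : C(unitInterval, ℝ))).comp continuous_snd

lemma isBern_zero_sub_of_mem_complMono {S : NNReal → ℝ} (hS : S ∈ complMono) :
    IsBern fun q => S 0 - S q := by
  have hcont : Continuous fun (T : NNReal → ℝ) (q : NNReal) => T 0 - T q := by fun_prop
  have hcl := isClosed_setOf_isBern.preimage hcont
  refine closure_minimal (t := (fun (T : NNReal → ℝ) (q : NNReal) => T 0 - T q) ⁻¹' {F | IsBern F})
    ?_ hcl hS
  intro T hT
  have hT' : T ∈ Submodule.span NNReal (powMonoid : Set (NNReal → ℝ)) := by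
    have := Algebra.adjoin_eq_span NNReal (powMonoid : Set (NNReal → ℝ))
    rw [Submonoid.closure_eq] at this
    rw [← this]
    exact hT
  clear hT
  change IsBern fun q => T 0 - T q
  induction hT' using Submodule.span_induction with
  | mem U hU =>
    obtain ⟨x, hx0, hx1, rfl⟩ := hU
    simpa using isBern_one_sub_rpow ⟨x, hx0, hx1⟩
  | zero => simpa using IsBern.zero
  | add U V _ _ h1 h2 =>
    convert h1.add h2 using 2 with q
    simp only [Pi.add_apply]; ring
  | smul c U _ h =>
    convert h.const_mul c.2 using 2 with q
    rw [mul_sub]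
    rfl

lemma IsBern.exists_levy_measure {F : NNReal → ℝ} (hF : IsBern F)
    (h0 : Tendsto F (𝓝[>] 0) (𝓝 0)) :
    ∃ a : ℝ, 0 ≤ a ∧ ∃ μ : Measure ℝ,
      (∫⁻ r in Ioi (0 : ℝ), ENNReal.ofReal (min 1 r) ∂μ < ⊤) ∧
      ∀ q : NNReal, F q = a * q + ∫ r in Ioi (0 : ℝ), (1 - Real.exp (-(q : ℝ) * r)) ∂μ := by
  obtain ⟨ρ, hρ⟩ := hF
  have hK0 : ∀ q : NNReal, 0 < q → bernKernel q 0 = 1 := fun q hq => by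
    have := one_sub_mul_bernKernel q 0
    have hq' : (q : ℝ) ≠ 0 := by exact_mod_cast hq.ne'
    simpa [Real.zero_rpow hq'] using this
  have hρ0 : (ρ : Measure unitInterval) {0} = 0 := by
    have hle : ∀ᶠ q : NNReal in 𝓝[>] 0, (ρ : Measure unitInterval).real {0} ≤ F q := by
      filter_upwards [self_mem_nhdsWithin] with q hq
      rw [hρ]
      calc (ρ : Measure unitInterval).real {0}
          = ∫ x in ({0} : Set unitInterval), bernKernel q x ∂(ρ : Measure unitInterval) := by
            rw [integral_singleton, hK0 q hq, smul_eq_mul, mul_one]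
        _ ≤ _ := setIntegral_le_integral (integrable_bernKernel q ρ)
            (Eventually.of_forall (bernKernel_nonneg q))
    have := le_antisymm (ge_of_tendsto h0 hle) measureReal_nonneg
    exact (measureReal_eq_zero_iff).1 this
  set A : Set unitInterval := {x | 0 < (x : ℝ) ∧ (x : ℝ) < 1} with hA
  have hAm : MeasurableSet A :=
    (measurableSet_lt measurable_const measurable_subtype_coe).inter
      (measurableSet_lt measurable_subtype_coe measurable_const)
  set g : unitInterval → ℝ := fun x => -Real.log x with hg
  have hgm : Measurable g := (Real.measurable_log.comp measurable_subtype_coe).neg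
  set w : unitInterval → NNReal := fun x => Real.toNNReal (1 - x)⁻¹ with hw
  have hwm : Measurable w := by fun_prop
  set κ : Measure unitInterval := ((ρ : Measure unitInterval).restrict A).withDensity
    fun x => (w x : ENNReal) with hκ
  have hpre : g ⁻¹' Ioi 0 ∩ A = A := by
    refine inter_eq_right.2 fun x hx => ?_
    simp only [hg, mem_preimage, mem_Ioi, Left.neg_pos_iff]
    exact Real.log_neg hx.1 hx.2
  have hκres : κ.restrict (g ⁻¹' Ioi 0) = κ := by
    rw [hκ, restrict_withDensity (hgm measurableSet_Ioi),
      Measure.restrict_restrict (hgm measurableSet_Ioi), hpre]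
  refine ⟨(ρ : Measure unitInterval).real {1}, measureReal_nonneg, κ.map g, ?_, fun q => ?_⟩
  · rw [setLIntegral_map measurableSet_Ioi (by fun_prop) hgm, hκres, hκ,
      lintegral_withDensity_eq_lintegral_mul _ (by fun_prop) (by fun_prop)]
    calc _ ≤ ∫⁻ x in A, 2 ∂(ρ : Measure unitInterval) := by
          refine setLIntegral_mono measurable_const fun x hx => ?_
          have h1 : 0 < 1 - (x : ℝ) := sub_pos.2 hx.2
          simp only [Pi.mul_apply, hw, hg]
          change ENNReal.ofReal _ * _ ≤ _
          rw [← ENNReal.ofReal_mul (by positivity)]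
          refine ENNReal.ofReal_le_of_le_toReal ?_
          rw [inv_mul_le_iff₀ h1]
          simp only [ENNReal.toReal_ofNat]
          by_cases hx2 : (x : ℝ) ≤ 1 / 2
          · exact (min_le_left _ _).trans (by linarith)
          · refine (min_le_right _ _).trans ?_
            have := Real.one_sub_inv_le_log_of_pos hx.1
            have h3 : (x : ℝ)⁻¹ - 1 ≤ (1 - x) * 2 := by
              rw [inv_eq_one_div, sub_le_iff_le_add, div_le_iff₀ hx.1]
              nlinarith
            linarith
      _ < ⊤ := by
          rw [lintegral_const]
          exact ENNReal.mul_lt_top (by simp) (measure_lt_top _ _)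
  · rw [setIntegral_map measurableSet_Ioi (by fun_prop) hgm.aemeasurable, hκres, hκ,
      integral_withDensity_eq_integral_smul hwm, hρ]
    have hAe : ∫ x in A, w x • (1 - Real.exp (-(q : ℝ) * g x)) ∂(ρ : Measure unitInterval) =
        ∫ x in A, bernKernel q x ∂(ρ : Measure unitInterval) := by
      refine setIntegral_congr_fun hAm fun x hx => ?_
      have h1 : 0 < 1 - (x : ℝ) := sub_pos.2 hx.2
      have h2 := one_sub_mul_bernKernel q x
      have h3 : Real.exp (-(q : ℝ) * g x) = (x : ℝ) ^ (q : ℝ) := by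
        rw [Real.rpow_def_of_pos hx.1, hg]; congr 1; ring
      simp only [hw, NNReal.smul_def, smul_eq_mul, h3, ← h2]
      rw [Real.coe_toNNReal _ (by positivity), inv_mul_cancel_left₀ h1.ne']
    rw [hAe, ← integral_add_compl (measurableSet_singleton (1 : unitInterval))
      (integrable_bernKernel q ρ)]
    congr 1
    · rw [integral_singleton, bernKernel_one_right, smul_eq_mul]
    · refine setIntegral_congr_set ?_
      have hne : ∀ᵐ x ∂(ρ : Measure unitInterval), x ≠ 0 := by
        rw [ae_iff]; simpa using hρ0
      filter_upwards [hne] with x hx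
      refine propext ⟨fun h => ⟨?_, ?_⟩, fun h h1 => ?_⟩
      · exact lt_of_le_of_ne x.2.1 fun h => hx (Subtype.ext h.symm)
      · exact lt_of_le_of_ne x.2.2 fun h' => h (Subtype.ext h')
      · rw [h1] at h
        exact absurd h.2 (by simp)

lemma succ_descFactorial_sub (n k : ℕ) :
    ((n + 1).descFactorial (k + 1) : ℝ) - n.descFactorial (k + 1) =
      (k + 1) * n.descFactorial k := by
  rw [Nat.succ_descFactorial_succ, Nat.descFactorial_succ]
  rcases le_or_gt k n with h | h
  · push_cast [Nat.cast_sub h]; ring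
  · simp [Nat.descFactorial_of_lt h]

lemma tendsto_descFactorial_div_pow (k : ℕ) :
    Tendsto (fun n : ℕ => (n.descFactorial k : ℝ) / (n : ℝ) ^ k) atTop (𝓝 1) := by
  induction k with
  | zero => simp
  | succ k ih =>
    have h1 : Tendsto (fun n : ℕ => 1 - (k : ℝ) / n) atTop (𝓝 (1 - 0)) :=
      (tendsto_const_div_atTop_nhds_zero_nat (k : ℝ)).const_sub 1
    have h2 := h1.mul ih
    rw [sub_zero, one_mul] at h2
    refine h2.congr' ?_
    filter_upwards [eventually_ge_atTop (k + 1)] with n hn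
    have hn0 : (n : ℝ) ≠ 0 := by
      have : n ≠ 0 := by omega
      exact_mod_cast this
    rw [Nat.descFactorial_succ, Nat.cast_mul, Nat.cast_sub (by omega)]
    field_simp
    ring

lemma descFactorial_div_pow_le_one (n k : ℕ) : (n.descFactorial k : ℝ) / (n : ℝ) ^ k ≤ 1 := by
  refine div_le_one_of_le₀ ?_ (by positivity)
  exact_mod_cast Nat.descFactorial_le_pow n k

lemma tendsto_sum_mul_descFactorial {w : ℕ → ℝ} (hw0 : ∀ k, 0 ≤ w k) (hw : Summable w) :
    Tendsto (fun n : ℕ => ∑ k ∈ Finset.range (n + 1),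
      w k * ((n.descFactorial k : ℝ) / (n : ℝ) ^ k)) atTop (𝓝 (∑' k, w k)) := by
  have h : Tendsto (fun n : ℕ => ∑' k, w k * ((n.descFactorial k : ℝ) / (n : ℝ) ^ k)) atTop
      (𝓝 (∑' k, w k)) := by
    refine tendsto_tsum_of_dominated_convergence hw (fun k => ?_) (Eventually.of_forall ?_)
    · simpa using (tendsto_descFactorial_div_pow k).const_mul (w k)
    · intro n k
      rw [Real.norm_of_nonneg (mul_nonneg (hw0 k) (by positivity))]
      exact mul_le_of_le_one_right (hw0 k) (descFactorial_div_pow_le_one n k)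
  refine h.congr fun n => tsum_eq_sum fun k hk => ?_
  rw [Nat.descFactorial_of_lt (by simpa [Nat.lt_succ_iff] using hk)]
  simp

/-- The series `∑ aₖ sᵏ n (n - 1) ⋯ (n - k + 1)`. -/
noncomputable def newtonSum (a : ℕ → ℝ) (s : ℝ) (n : ℕ) : ℝ :=
  ∑ k ∈ Finset.range (n + 1), a k * s ^ k * n.descFactorial k

section newtonSum

variable {a : ℕ → ℝ}

lemma newtonSum_eq_sum_range (s : ℝ) {n M : ℕ} (h : n + 1 ≤ M) :
    newtonSum a s n = ∑ k ∈ Finset.range M, a k * s ^ k * n.descFactorial k := by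
  refine Finset.sum_subset (Finset.range_mono h) fun k _ hk => ?_
  rw [Nat.descFactorial_of_lt (by simpa [Nat.lt_succ_iff] using hk)]
  simp

lemma newtonSum_succ_sub (s : ℝ) {n M : ℕ} (h : n + 1 ≤ M) :
    newtonSum a s (n + 1) - newtonSum a s n =
      ∑ k ∈ Finset.range M, a (k + 1) * s ^ (k + 1) * ((k + 1) * n.descFactorial k) := by
  rw [newtonSum_eq_sum_range s (show n + 1 + 1 ≤ M + 1 by omega),
    newtonSum_eq_sum_range s (show n + 1 ≤ M + 1 by omega), ← Finset.sum_sub_distrib,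
    Finset.sum_range_succ']
  simp only [Nat.descFactorial_zero, sub_self, add_zero]
  refine Finset.sum_congr rfl fun k _ => ?_
  rw [← succ_descFactorial_sub]; ring

lemma newtonSum_zero_left (ha0 : a 0 = 1) (n : ℕ) : newtonSum a 0 n = 1 := by
  rw [newtonSum, Finset.sum_range_succ']
  simp [ha0]

lemma one_le_newtonSum (ha0 : a 0 = 1) (ha : ∀ n, 0 < a n) {s : ℝ} (hs : 0 ≤ s) (n : ℕ) :
    1 ≤ newtonSum a s n := by
  rw [newtonSum, Finset.sum_range_succ']
  have : 0 ≤ ∑ k ∈ Finset.range n, a (k + 1) * s ^ (k + 1) * n.descFactorial (k + 1) :=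
    Finset.sum_nonneg fun k _ => by have := ha (k + 1); positivity
  simpa [ha0] using this

lemma newtonSum_le_succ (ha : ∀ n, 0 < a n) {s : ℝ} (hs : 0 ≤ s) (n : ℕ) :
    newtonSum a s n ≤ newtonSum a s (n + 1) := by
  rw [← sub_nonneg, newtonSum_succ_sub s le_rfl]
  exact Finset.sum_nonneg fun k _ => by have := ha (k + 1); positivity

lemma newtonSum_succ_sub_mono (ha : ∀ n, 0 < a n) {s : ℝ} (hs : 0 ≤ s) {j n : ℕ} (hj : j ≤ n) :
    newtonSum a s (j + 1) - newtonSum a s j ≤ newtonSum a s (n + 1) - newtonSum a s n := by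
  rw [newtonSum_succ_sub s (show j + 1 ≤ n + 1 by omega), newtonSum_succ_sub s le_rfl]
  refine Finset.sum_le_sum fun k _ => ?_
  have := ha (k + 1)
  have h2 : (j.descFactorial k : ℝ) ≤ n.descFactorial k := by
    exact_mod_cast Nat.descFactorial_le k hj
  gcongr

lemma succ_mul_newtonSum_succ_sub (q : ℝ) (n : ℕ) :
    ((n + 1 : ℕ) : ℝ) * (newtonSum a (q / (n + 1 : ℕ)) (n + 1) - newtonSum a (q / (n + 1 : ℕ)) n) =
      ∑ k ∈ Finset.range (n + 1 + 1), (k * a k * q ^ k) *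
        (((n + 1).descFactorial k : ℝ) / ((n + 1 : ℕ) : ℝ) ^ k) := by
  rw [newtonSum_succ_sub _ le_rfl, Finset.sum_range_succ' _ (n + 1), Finset.mul_sum]
  simp only [Nat.cast_zero, zero_mul, add_zero]
  refine Finset.sum_congr rfl fun k _ => ?_
  rw [Nat.succ_descFactorial_succ, div_pow]
  push_cast
  ring

lemma newtonSum_div_eq (q : ℝ) (n : ℕ) :
    newtonSum a (q / n) n = ∑ k ∈ Finset.range (n + 1), (a k * q ^ k) *
        ((n.descFactorial k : ℝ) / (n : ℝ) ^ k) := by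
  refine Finset.sum_congr rfl fun k _ => ?_
  rw [div_pow]; ring

/-- `newtonSum` is an eigenfunction of the operator sending `n(n-1)⋯(n-k+1)` to
`pₖ n(n-1)⋯(n-k+2)`. -/
lemma newtonSum_eigen {p : ℕ → ℝ} (hap : ∀ n, a n = a (n + 1) * p (n + 1)) {u : ℝ} {n : ℕ}
    {ℓ : ℕ → ℝ}
    (h : ∀ k, p (k + 1) * n.descFactorial k = u * ((k + 1) * n.descFactorial k) +
      ∑ j ∈ Finset.range n, ℓ j * ((j.descFactorial (k + 1) : ℝ) - n.descFactorial (k + 1)))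
    (s : ℝ) :
    s * newtonSum a s n = u * (newtonSum a s (n + 1) - newtonSum a s n) +
      ∑ j ∈ Finset.range n, ℓ j * (newtonSum a s j - newtonSum a s n) := by
  have h1 : ∀ j ∈ Finset.range n, ℓ j * (newtonSum a s j - newtonSum a s n) =
      ∑ k ∈ Finset.range (n + 1), a (k + 1) * s ^ (k + 1) *
        (ℓ j * ((j.descFactorial (k + 1) : ℝ) - n.descFactorial (k + 1))) := by
    intro j hj
    have hj := Finset.mem_range.1 hj
    rw [newtonSum_eq_sum_range s (show j + 1 ≤ n + 1 + 1 by omega),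
      newtonSum_eq_sum_range s (show n + 1 ≤ n + 1 + 1 by omega), ← Finset.sum_sub_distrib,
      Finset.sum_range_succ' _ (n + 1), mul_add, Finset.mul_sum]
    simp only [Nat.descFactorial_zero, sub_self, mul_zero, add_zero]
    refine Finset.sum_congr rfl fun k _ => ?_
    ring
  rw [Finset.sum_congr rfl h1, Finset.sum_comm, newtonSum_succ_sub s le_rfl, Finset.mul_sum,
    ← Finset.sum_add_distrib, newtonSum, Finset.mul_sum]
  refine Finset.sum_congr rfl fun k _ => ?_
  rw [← Finset.mul_sum, hap k]
  linear_combination a (k + 1) * s ^ (k + 1) * h k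

end newtonSum

section SkipFree

variable {a p : ℕ → ℝ} {ℓ : ℕ → ℕ → ℝ}

lemma isBern_one_sub_newtonSum_ratio (ha0 : a 0 = 1) (ha : ∀ n, 0 < a n)
    (hap : ∀ n, a n = a (n + 1) * p (n + 1)) (hp : ∀ n, 0 < p (n + 1))
    (hℓ : ∀ n j, 0 ≤ ℓ n j)
    (hchain : ∀ n k, p (k + 1) * n.descFactorial k =
      p (n + 1) / (n + 1) * ((k + 1) * n.descFactorial k) +
      ∑ j ∈ Finset.range n, ℓ n j * ((j.descFactorial (k + 1) : ℝ) - n.descFactorial (k + 1)))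
    (N j : ℕ) :
    IsBern fun q => 1 - newtonSum a (q / N) j / newtonSum a (q / N) (j + 1) := by
  have hs : ∀ q : NNReal, 0 ≤ (q : ℝ) / N := fun q => by positivity
  have hpos : ∀ n (q : NNReal), 0 < newtonSum a (q / N) n := fun n q =>
    one_pos.trans_le (one_le_newtonSum ha0 ha (hs q) n)
  have hmem := skipFree_ratio_mem_complMono (f := fun n (q : NNReal) => newtonSum a (q / N) n)
    (up := fun n => p (n + 1) / (n + 1)) (ℓ := ℓ) (ε := 1 / N) (by positivity) hpos
    (fun q => monotone_nat_of_le_succ fun n => newtonSum_le_succ ha (hs q) n)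
    (fun n => div_pos (hp n) (by positivity)) hℓ
    (fun n q => by rw [one_div_mul_eq_div]; exact newtonSum_eigen hap (hchain n) _) (j + 1) j
    (Nat.le_succ j)
  convert isBern_zero_sub_of_mem_complMono hmem using 2 with q
  simp [newtonSum_zero_left ha0]

lemma log_le_and_le_log {f : ℕ → ℝ} {d : ℝ} (hf0 : f 0 = 1) (hf : ∀ n, 1 ≤ f n) (n : ℕ)
    (hd0 : ∀ j < n, 0 ≤ f (j + 1) - f j) (hd : ∀ j < n, f (j + 1) - f j ≤ d) :
    0 ≤ Real.log (f n) - ∑ j ∈ Finset.range n, (1 - f j / f (j + 1)) ∧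
      Real.log (f n) - ∑ j ∈ Finset.range n, (1 - f j / f (j + 1)) ≤ n * d ^ 2 := by
  have hsum : Real.log (f n) - ∑ j ∈ Finset.range n, (1 - f j / f (j + 1)) =
      ∑ j ∈ Finset.range n, (Real.log (f (j + 1)) - Real.log (f j) - (1 - f j / f (j + 1))) := by
    rw [Finset.sum_sub_distrib _ (fun j => 1 - f j / f (j + 1)),
      Finset.sum_range_sub (fun j => Real.log (f j)), hf0, Real.log_one, sub_zero]
  have hpos : ∀ j, 0 < f j := fun j => one_pos.trans_le (hf j)
  rw [hsum]
  constructor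
  · refine Finset.sum_nonneg fun j _ => ?_
    have h := Real.log_le_sub_one_of_pos (div_pos (hpos j) (hpos (j + 1)))
    rw [Real.log_div (hpos j).ne' (hpos _).ne'] at h
    linarith
  · calc _ ≤ ∑ j ∈ Finset.range n, d ^ 2 := Finset.sum_le_sum fun j hj => by
          have hj := Finset.mem_range.1 hj
          have h := Real.log_le_sub_one_of_pos (div_pos (hpos (j + 1)) (hpos j))
          rw [Real.log_div (hpos _).ne' (hpos _).ne'] at h
          have e : f (j + 1) / f j - 1 - (1 - f j / f (j + 1)) =
              (f (j + 1) - f j) ^ 2 / (f j * f (j + 1)) := by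
            have := (hpos j).ne'
            have := (hpos (j + 1)).ne'
            field_simp
          have h2 : (f (j + 1) - f j) ^ 2 / (f j * f (j + 1)) ≤ (f (j + 1) - f j) ^ 2 :=
            div_le_self (sq_nonneg _) (one_le_mul_of_one_le_of_one_le (hf j) (hf (j + 1)))
          have h3 : (f (j + 1) - f j) ^ 2 ≤ d ^ 2 := pow_le_pow_left₀ (hd0 j hj) (hd j hj) 2
          linarith
      _ = n * d ^ 2 := by simp

lemma isBern_log_add_logDeriv (ha0 : a 0 = 1) (ha : ∀ n, 0 < a n)
    (hap : ∀ n, a n = a (n + 1) * p (n + 1)) (hp : ∀ n, 0 < p (n + 1))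
    (hℓ : ∀ n j, 0 ≤ ℓ n j)
    (hchain : ∀ n k, p (k + 1) * n.descFactorial k =
      p (n + 1) / (n + 1) * ((k + 1) * n.descFactorial k) +
      ∑ j ∈ Finset.range n, ℓ n j * ((j.descFactorial (k + 1) : ℝ) - n.descFactorial (k + 1)))
    (hs0 : ∀ x : ℝ, 0 ≤ x → Summable fun k => a k * x ^ k)
    (hs1 : ∀ x : ℝ, 0 ≤ x → Summable fun k => k * a k * x ^ k) :
    IsBern fun q => Real.log (∑' k, a k * (q : ℝ) ^ k) +
      (∑' k, k * a k * (q : ℝ) ^ k) / ∑' k, a k * (q : ℝ) ^ k := by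
  let f : ℕ → NNReal → ℕ → ℝ := fun n q j => newtonSum a (q / (n + 1 : ℕ)) j
  suffices h : _ ∈ {F : NNReal → ℝ | IsBern F} from h
  refine isClosed_setOf_isBern.mem_of_tendsto (b := atTop) (f := fun n : ℕ => fun q : NNReal =>
    (∑ j ∈ Finset.range (n + 1), (1 - f n q j / f n q (j + 1))) +
      ((n + 1 : ℕ) : ℝ) * (1 - f n q n / f n q (n + 1))) ?_ (Eventually.of_forall fun n => ?_)
  swap
  · have h := isBern_one_sub_newtonSum_ratio ha0 ha hap hp hℓ hchain (n + 1)
    exact (IsBern.sum _ fun j _ => h j).add ((h n).const_mul (Nat.cast_nonneg _))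
  rw [tendsto_pi_nhds]
  intro q
  set I := ∑' k, a k * (q : ℝ) ^ k with hI
  set J := ∑' k, k * a k * (q : ℝ) ^ k with hJ
  have ht0 : ∀ k, 0 ≤ a k * (q : ℝ) ^ k := fun k => by have := ha k; positivity
  have ht1 : ∀ k : ℕ, 0 ≤ k * a k * (q : ℝ) ^ k := fun k => by have := ha k; positivity
  have hfI : Tendsto (fun n => f n q (n + 1)) atTop (𝓝 I) := by
    refine ((tendsto_sum_mul_descFactorial ht0 (hs0 q q.2)).comp (tendsto_add_atTop_nat 1)).congr
      fun n => ?_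
    exact (newtonSum_div_eq (q : ℝ) (n + 1)).symm
  have hfJ : Tendsto (fun n => ((n + 1 : ℕ) : ℝ) * (f n q (n + 1) - f n q n)) atTop (𝓝 J) := by
    refine ((tendsto_sum_mul_descFactorial ht1 (hs1 q q.2)).comp (tendsto_add_atTop_nat 1)).congr
      fun n => ?_
    exact (succ_mul_newtonSum_succ_sub (q : ℝ) n).symm
  have hs : ∀ n : ℕ, 0 ≤ (q : ℝ) / (n + 1 : ℕ) := fun n => by positivity
  have hf1 : ∀ n j, 1 ≤ f n q j := fun n j => one_le_newtonSum ha0 ha (hs n) j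
  have hI1 : 1 ≤ I := ge_of_tendsto hfI (Eventually.of_forall fun n => hf1 n (n + 1))
  have hI0 : I ≠ 0 := by linarith
  refine Tendsto.add ?_ ?_
  · have hlog : Tendsto (fun n => Real.log (f n q (n + 1))) atTop (𝓝 (Real.log I)) := hfI.log hI0
    have herr : Tendsto (fun n => Real.log (f n q (n + 1)) -
        ∑ j ∈ Finset.range (n + 1), (1 - f n q j / f n q (j + 1))) atTop (𝓝 0) := by
      have hbd := fun n => log_le_and_le_log (f := f n q) (d := f n q (n + 1) - f n q n)
        (by simp [f, newtonSum, ha0]) (hf1 n) (n + 1)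
        (fun j _ => sub_nonneg.2 (newtonSum_le_succ ha (hs n) j))
        (fun j hj => newtonSum_succ_sub_mono ha (hs n) (Nat.lt_succ_iff.1 hj))
      have hz : Tendsto (fun n => (((n + 1 : ℕ) : ℝ) * (f n q (n + 1) - f n q n)) ^ 2 *
          (1 / ((n : ℝ) + 1))) atTop (𝓝 0) := by
        simpa using (hfJ.pow 2).mul tendsto_one_div_add_atTop_nhds_zero_nat
      refine tendsto_of_tendsto_of_tendsto_of_le_of_le tendsto_const_nhds hz
        (fun n => (hbd n).1) (fun n => (hbd n).2.trans_eq ?_)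
      push_cast
      field_simp
    have := hlog.sub herr
    simpa using this
  · refine (hfJ.div hfI hI0).congr fun n => ?_
    have : f n q (n + 1) ≠ 0 := by linarith [hf1 n (n + 1)]
    simp only [Pi.div_apply]
    field_simp

end SkipFree

lemma tendsto_log_add_logDeriv {a : ℕ → ℝ} (ha0 : a 0 = 1) (ha : ∀ n, 0 < a n)
    (hs0 : ∀ x : ℝ, 0 ≤ x → Summable fun k => a k * x ^ k)
    (hs1 : ∀ x : ℝ, 0 ≤ x → Summable fun k => k * a k * x ^ k) :
    Tendsto (fun q : NNReal => Real.log (∑' k, a k * (q : ℝ) ^ k) +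
      (∑' k, k * a k * (q : ℝ) ^ k) / ∑' k, a k * (q : ℝ) ^ k) (𝓝[>] 0) (𝓝 0) := by
  set J := ∑' k, k * a k * (1 : ℝ) ^ k with hJ
  have hq : Tendsto (fun q : NNReal => 2 * ((q : ℝ) * J)) (𝓝[>] 0) (𝓝 0) := by
    have : Continuous fun q : NNReal => 2 * ((q : ℝ) * J) := by fun_prop
    have h := this.tendsto 0
    simp only [NNReal.coe_zero, zero_mul, mul_zero] at h
    exact h.mono_left nhdsWithin_le_nhds
  have hle : ∀ q : NNReal, q ≤ 1 → 1 ≤ ∑' k, a k * (q : ℝ) ^ k ∧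
      ∑' k, a k * (q : ℝ) ^ k ≤ 1 + q * J ∧ 0 ≤ ∑' k, k * a k * (q : ℝ) ^ k ∧
      ∑' k, k * a k * (q : ℝ) ^ k ≤ q * J := by
    intro q hq1
    have hq1' : (q : ℝ) ≤ 1 := by exact_mod_cast hq1
    have hJq : ∀ k : ℕ, k * a k * (q : ℝ) ^ k ≤ q * (k * a k * 1 ^ k) := fun k => by
      have hk := ha k
      rcases k with _ | k
      · simp
      · have : (q : ℝ) ^ (k + 1) ≤ q := pow_le_of_le_one q.2 hq1' (by omega)
        have h2 : (0 : ℝ) ≤ ((k + 1 : ℕ) : ℝ) * a (k + 1) := by positivity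
        have := mul_le_mul_of_nonneg_left this h2
        rw [one_pow]; linarith
    have hJle := (hs1 q q.2).tsum_le_tsum hJq ((hs1 1 zero_le_one).mul_left (q : ℝ))
    rw [tsum_mul_left] at hJle
    have hsplit := (hs0 q q.2).tsum_eq_zero_add
    have htail : Summable fun k => a (k + 1) * (q : ℝ) ^ (k + 1) :=
      (summable_nat_add_iff 1).2 (hs0 q q.2)
    have hsplit1 := (hs1 q q.2).tsum_eq_zero_add
    have htail1 : Summable fun k : ℕ => ((k + 1 : ℕ) : ℝ) * a (k + 1) * (q : ℝ) ^ (k + 1) :=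
      (summable_nat_add_iff 1).2 (hs1 q q.2)
    have h0 : 0 ≤ ∑' k, a (k + 1) * (q : ℝ) ^ (k + 1) :=
      tsum_nonneg fun k => by have := ha (k + 1); positivity
    have h1 : ∑' k, a (k + 1) * (q : ℝ) ^ (k + 1) ≤
        ∑' k : ℕ, ((k + 1 : ℕ) : ℝ) * a (k + 1) * (q : ℝ) ^ (k + 1) := by
      refine htail.tsum_le_tsum (fun k => ?_) htail1
      have := ha (k + 1)
      have h1 : (1 : ℝ) ≤ ((k + 1 : ℕ) : ℝ) := by push_cast; linarith [k.cast_nonneg (α := ℝ)]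
      gcongr
      exact le_mul_of_one_le_left this.le h1
    simp only [pow_zero, ha0, mul_one, Nat.cast_zero, zero_add] at hsplit hsplit1
    refine ⟨by linarith, by linarith, by linarith, hJle⟩
  have hev : ∀ᶠ q : NNReal in 𝓝[>] 0, q ≤ 1 :=
    nhdsWithin_le_nhds (Iic_mem_nhds one_pos)
  refine tendsto_of_tendsto_of_tendsto_of_le_of_le' tendsto_const_nhds hq ?_ ?_
  · filter_upwards [hev] with q hq1
    obtain ⟨h1, h2, h3, h4⟩ := hle q hq1
    have := Real.log_nonneg h1
    positivity
  · filter_upwards [hev] with q hq1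
    obtain ⟨h1, h2, h3, h4⟩ := hle q hq1
    have h5 := Real.log_le_sub_one_of_pos (one_pos.trans_le h1)
    have h6 := div_le_self h3 h1
    linarith

lemma sum_choose_mul_pow_mul_descFactorial (u v : ℝ) (k : ℕ) : ∀ N : ℕ,
    ∑ j ∈ Finset.range (N + 1), (N.choose j * u ^ j * v ^ (N - j)) * j.descFactorial k =
      u ^ k * (u + v) ^ (N - k) * N.descFactorial k := by
  induction k with
  | zero =>
    intro N
    simp only [Nat.descFactorial_zero, Nat.cast_one, mul_one, pow_zero, one_mul, Nat.sub_zero]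
    rw [add_pow]
    exact Finset.sum_congr rfl fun j _ => by ring
  | succ k ih =>
    rintro (_ | N)
    · simp
    · rw [Finset.sum_range_succ']
      have h : ∀ j ∈ Finset.range (N + 1),
          ((N + 1).choose (j + 1) * u ^ (j + 1) * v ^ (N + 1 - (j + 1))) *
            ((j + 1).descFactorial (k + 1) : ℝ) =
          (N + 1) * u * ((N.choose j * u ^ j * v ^ (N - j)) * j.descFactorial k) := by
        intro j _
        have hc : ((N : ℝ) + 1) * N.choose j = (N + 1).choose (j + 1) * (j + 1) := by
          exact_mod_cast Nat.add_one_mul_choose_eq N j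
        rw [Nat.succ_descFactorial_succ, Nat.add_sub_add_right]
        push_cast
        linear_combination (-(u ^ (j + 1) * v ^ (N - j) * j.descFactorial k)) * hc
      rw [Finset.sum_congr rfl h, ← Finset.mul_sum, ih N, Nat.succ_descFactorial_succ,
        Nat.add_sub_add_right]
      simp
      ring

lemma pow_sub_mul_descFactorial_eq (u : ℝ) (n k : ℕ) :
    (u ^ (k + 1) - 1 + (k + 1) * (1 - u)) * n.descFactorial k =
      (u ^ (n + 1) - 1 + (n + 1) * (1 - u)) / (n + 1) * ((k + 1) * n.descFactorial k) +
      ∑ j ∈ Finset.range n, ((n + 1).choose j * u ^ j * (1 - u) ^ (n + 1 - j) / (n + 1)) *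
        ((j.descFactorial (k + 1) : ℝ) - n.descFactorial (k + 1)) := by
  have hA := sum_choose_mul_pow_mul_descFactorial u (1 - u) (k + 1) (n + 1)
  have hB := sum_choose_mul_pow_mul_descFactorial u (1 - u) 0 (n + 1)
  have hd := succ_descFactorial_sub n k
  rw [Nat.succ_descFactorial_succ] at hA hd
  simp only [add_sub_cancel, one_pow, mul_one, pow_zero, Nat.descFactorial_zero,
    Nat.cast_one, Nat.cast_mul, Nat.cast_add] at hA hB hd
  have hC : ∑ j ∈ Finset.range (n + 1 + 1), ((n + 1).choose j * u ^ j * (1 - u) ^ (n + 1 - j)) *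
      ((j.descFactorial (k + 1) : ℝ) - n.descFactorial (k + 1)) =
      u ^ (k + 1) * ((n + 1) * n.descFactorial k) - n.descFactorial (k + 1) := by
    simp only [mul_sub, Finset.sum_sub_distrib, ← Finset.sum_mul, hA, hB, one_mul]
  rw [Finset.sum_range_succ, Finset.sum_range_succ] at hC
  simp only [sub_self, Nat.sub_self, mul_zero, add_zero, Nat.choose_self, Nat.cast_one, one_mul,
    pow_zero,
    mul_one, succ_descFactorial_sub] at hC
  have hn : (n : ℝ) + 1 ≠ 0 := by positivity
  simp only [div_mul_eq_mul_div, ← Finset.sum_div]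
  rw [← add_div, eq_div_iff hn]
  linear_combination (-1 : ℝ) * hC - hd

lemma mul_descFactorial_eq (n k : ℕ) :
    ((k : ℝ) + 1) * k * n.descFactorial k = n * ((k + 1) * n.descFactorial k) +
      ∑ j ∈ Finset.range n, (if j + 1 = n then (n : ℝ) else 0) *
        ((j.descFactorial (k + 1) : ℝ) - n.descFactorial (k + 1)) := by
  rcases n with _ | m
  · rcases k with _ | k <;> simp
  · rw [Finset.sum_range_succ, Finset.sum_eq_zero fun j hj => by
      rw [if_neg (by have := Finset.mem_range.1 hj; omega), zero_mul]]
    have h1 := succ_descFactorial_sub m k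
    have h2 := succ_descFactorial_sub (m + 1) k
    rw [Nat.succ_descFactorial_succ] at h2
    have h3 : (((m + 1).descFactorial (k + 1) : ℕ) : ℝ) = (m + 1) * m.descFactorial k := by
      rw [Nat.succ_descFactorial_succ]; push_cast; ring
    push_cast at h2 ⊢
    simp only [if_true]
    rw [h3] at h1 h2 ⊢
    linear_combination ((m : ℝ) + 1) * h1 - ((k : ℝ) + 1) * h2

section Levy

variable {σ b : ℝ} {ν : Measure ℝ}

lemma integrableOn_min_one_sq
    (hν : ∫⁻ r in Ioi (0 : ℝ), ENNReal.ofReal (min 1 (r ^ 2)) ∂ν < ⊤) :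
    IntegrableOn (fun r => min 1 (r ^ 2)) (Ioi (0 : ℝ)) ν := by
  refine ⟨by fun_prop, ?_⟩
  rw [hasFiniteIntegral_iff_ofReal (Eventually.of_forall fun r => by positivity)]
  exact hν

lemma abs_psi_integrand_le {u r : ℝ} (hu : 0 ≤ u) (hr : 0 < r) :
    |Real.exp (-u * r) - 1 + (if r ≤ 1 then u * r else 0)| ≤ (1 + u ^ 2) * min 1 (r ^ 2) := by
  have h0 : 0 ≤ u * r := by positivity
  have h1 := Real.add_one_le_exp (-u * r)
  have h2 : Real.exp (-u * r) ≤ 1 := by rw [Real.exp_le_one_iff]; linarith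
  have h3 := Real.exp_pos (-u * r)
  split_ifs with h
  · have h4 : Real.exp (-u * r) ≤ 1 - u * r + (u * r) ^ 2 := by
      have h5 := Real.add_one_le_exp (u * r)
      rw [neg_mul, Real.exp_neg]
      calc (Real.exp (u * r))⁻¹ ≤ (u * r + 1)⁻¹ := inv_anti₀ (by linarith) h5
        _ ≤ _ := by
          rw [inv_le_iff_one_le_mul₀ (by linarith)]
          nlinarith [pow_nonneg h0 3]
    rw [min_eq_right (by nlinarith), abs_of_nonneg (by linarith)]
    nlinarith [sq_nonneg r]
  · rw [min_eq_left (by nlinarith), abs_le]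
    constructor <;> nlinarith [sq_nonneg u]

lemma integrableOn_psi_integrand
    (hν : ∫⁻ r in Ioi (0 : ℝ), ENNReal.ofReal (min 1 (r ^ 2)) ∂ν < ⊤) {u : ℝ} (hu : 0 ≤ u) :
    IntegrableOn (fun r => Real.exp (-u * r) - 1 + (if r ≤ 1 then u * r else 0)) (Ioi 0) ν := by
  refine Integrable.mono' ((integrableOn_min_one_sq hν).const_mul (1 + u ^ 2)) ?_ ?_
  · refine Measurable.aestronglyMeasurable ?_
    refine Measurable.add (by fun_prop) (Measurable.ite measurableSet_Iic (by fun_prop) (by fun_prop))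
  · filter_upwards [ae_restrict_mem measurableSet_Ioi] with r hr
    exact abs_psi_integrand_le hu hr

lemma psi_sub_mul_psi
    (hν : ∫⁻ r in Ioi (0 : ℝ), ENNReal.ofReal (min 1 (r ^ 2)) ∂ν < ⊤) {u v : ℝ} (hu : 0 ≤ u)
    (hv : 0 ≤ v) (c : ℝ) (huv : u = c * v) :
    IntegrableOn (fun r => Real.exp (-u * r) - 1 - c * (Real.exp (-v * r) - 1)) (Ioi 0) ν ∧
    psi σ b ν u = c * psi σ b ν v + σ / 2 * (u ^ 2 - u * v) +
      ∫ r in Ioi (0 : ℝ), (Real.exp (-u * r) - 1 - c * (Real.exp (-v * r) - 1)) ∂ν := by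
  have h1 := integrableOn_psi_integrand hν hu
  have h2 := (integrableOn_psi_integrand hν hv).const_mul c
  have e : (fun r => Real.exp (-u * r) - 1 - c * (Real.exp (-v * r) - 1)) = fun r =>
      (Real.exp (-u * r) - 1 + (if r ≤ 1 then u * r else 0)) -
        c * (Real.exp (-v * r) - 1 + (if r ≤ 1 then v * r else 0)) := by
    ext r
    rw [huv]
    split_ifs <;> ring
  rw [e]
  refine ⟨h1.sub h2, ?_⟩
  rw [integral_sub h1 h2, integral_const_mul, psi, psi]
  rw [huv]
  ring

lemma integrableOn_binomial
    (hν : ∫⁻ r in Ioi (0 : ℝ), ENNReal.ofReal (min 1 (r ^ 2)) ∂ν < ⊤) {α : ℝ} (hα : 0 < α)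
    (C : ℝ) (i m : ℕ) (hm : 2 ≤ m) :
    IntegrableOn (fun r => C * Real.exp (-α * r) ^ i * (1 - Real.exp (-α * r)) ^ m)
      (Ioi 0) ν := by
  refine Integrable.mono' ((integrableOn_min_one_sq hν).const_mul (|C| * (1 + α ^ 2)))
    (by fun_prop) ?_
  filter_upwards [ae_restrict_mem measurableSet_Ioi] with r hr
  have hr : 0 < r := hr
  have h0 : 0 ≤ α * r := by positivity
  have h1 := Real.add_one_le_exp (-α * r)
  have h2 : Real.exp (-α * r) ≤ 1 := by rw [Real.exp_le_one_iff]; linarith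
  have h3 := Real.exp_pos (-α * r)
  have h4 : Real.exp (-α * r) ^ i ≤ 1 := pow_le_one₀ h3.le h2
  have h5 : (1 - Real.exp (-α * r)) ^ m ≤ (1 - Real.exp (-α * r)) ^ 2 :=
    pow_le_pow_of_le_one (by linarith) (by linarith) hm
  have h6 : (1 - Real.exp (-α * r)) ^ 2 ≤ (1 + α ^ 2) * min 1 (r ^ 2) := by
    rcases le_total 1 (r ^ 2) with h | h
    · rw [min_eq_left h]; nlinarith [sq_nonneg α]
    · rw [min_eq_right h]
      calc _ ≤ (α * r) ^ 2 := by
            refine pow_le_pow_left₀ (by linarith) (by linarith) 2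
        _ ≤ _ := by nlinarith [sq_nonneg r]
  have h7 : 0 ≤ (1 - Real.exp (-α * r)) ^ m := pow_nonneg (by linarith) m
  rw [norm_mul, norm_mul, Real.norm_eq_abs, Real.norm_of_nonneg (pow_nonneg h3.le i),
    Real.norm_of_nonneg h7, mul_assoc, mul_assoc]
  refine mul_le_mul_of_nonneg_left ?_ (abs_nonneg C)
  calc _ ≤ 1 * (1 - Real.exp (-α * r)) ^ m := mul_le_mul_of_nonneg_right h4 h7
    _ ≤ _ := by linarith

lemma psi_nat_eq
    (hν : ∫⁻ r in Ioi (0 : ℝ), ENNReal.ofReal (min 1 (r ^ 2)) ∂ν < ⊤) {α : ℝ} (hα : 0 < α)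
    (n : ℕ) :
    IntegrableOn (fun r => Real.exp (-α * r) ^ (n + 1) - 1 + (n + 1) * (1 - Real.exp (-α * r)))
      (Ioi 0) ν ∧
    psi σ b ν (α * (n + 1)) = (n + 1) * psi σ b ν α + σ / 2 * α ^ 2 * ((n + 1) * n) +
      ∫ r in Ioi (0 : ℝ),
        (Real.exp (-α * r) ^ (n + 1) - 1 + (n + 1) * (1 - Real.exp (-α * r))) ∂ν := by
  have h := psi_sub_mul_psi (σ := σ) (b := b) hν (u := α * (n + 1)) (v := α) (by positivity) hα.le
    (n + 1) (by ring)
  have e : (fun r => Real.exp (-(α * (n + 1)) * r) - 1 - (n + 1) * (Real.exp (-α * r) - 1)) =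
      fun r => Real.exp (-α * r) ^ (n + 1) - 1 + (n + 1) * (1 - Real.exp (-α * r)) := by
    ext r
    rw [← Real.exp_nat_mul, show -(α * ((n : ℝ) + 1)) * r = ((n + 1 : ℕ) : ℝ) * (-α * r) by
      push_cast; ring]
    ring
  rw [e] at h
  refine ⟨h.1, ?_⟩
  rw [h.2]; ring

lemma mul_psi_le_psi_nat (hσ : 0 ≤ σ)
    (hν : ∫⁻ r in Ioi (0 : ℝ), ENNReal.ofReal (min 1 (r ^ 2)) ∂ν < ⊤) {α : ℝ} (hα : 0 < α)
    (n : ℕ) : (n + 1) * psi σ b ν α ≤ psi σ b ν (α * (n + 1)) := by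
  rw [(psi_nat_eq hν hα n).2, add_assoc]
  have h1 : 0 ≤ ∫ r in Ioi (0 : ℝ),
      (Real.exp (-α * r) ^ (n + 1) - 1 + (n + 1) * (1 - Real.exp (-α * r))) ∂ν := by
    refine integral_nonneg fun r => ?_
    have h2 := one_add_mul_sub_le_pow (a := Real.exp (-α * r)) (by
      have := Real.exp_pos (-α * r); linarith) (n + 1)
    push_cast at h2
    simp only [Pi.zero_apply]
    linarith
  have : 0 ≤ σ / 2 * α ^ 2 * (((n : ℝ) + 1) * n) := by positivity
  linarith

lemma exists_skipFree_rates (hσ : 0 ≤ σ)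
    (hν : ∫⁻ r in Ioi (0 : ℝ), ENNReal.ofReal (min 1 (r ^ 2)) ∂ν < ⊤) {α : ℝ} (hα : 0 < α) :
    ∃ ℓ : ℕ → ℕ → ℝ, (∀ n j, 0 ≤ ℓ n j) ∧ ∀ n k : ℕ,
      psi σ b ν (α * (k + 1)) * n.descFactorial k =
        psi σ b ν (α * (n + 1)) / (n + 1) * ((k + 1) * n.descFactorial k) +
        ∑ j ∈ Finset.range n,
          ℓ n j * ((j.descFactorial (k + 1) : ℝ) - n.descFactorial (k + 1)) := by
  refine ⟨fun n j => σ / 2 * α ^ 2 * (if j + 1 = n then (n : ℝ) else 0) + ∫ r in Ioi (0 : ℝ),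
    ((n + 1).choose j * Real.exp (-α * r) ^ j * (1 - Real.exp (-α * r)) ^ (n + 1 - j) / (n + 1))
      ∂ν, fun n j => ?_, fun n k => ?_⟩
  · refine add_nonneg (by positivity) (setIntegral_nonneg measurableSet_Ioi fun r hr => ?_)
    have hr : 0 < r := hr
    have h2 : Real.exp (-α * r) ≤ 1 := by
      rw [Real.exp_le_one_iff]; nlinarith
    have h3 : 0 ≤ 1 - Real.exp (-α * r) := by linarith
    positivity
  · have hWint : ∀ j ∈ Finset.range n, IntegrableOn (fun r => ((n + 1).choose j *
        Real.exp (-α * r) ^ j * (1 - Real.exp (-α * r)) ^ (n + 1 - j) / ((n : ℝ) + 1)) *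
        ((j.descFactorial (k + 1) : ℝ) - n.descFactorial (k + 1))) (Ioi 0) ν := by
      intro j hj
      have := Finset.mem_range.1 hj
      exact ((integrableOn_binomial hν hα _ j (n + 1 - j) (by omega)).div_const _).mul_const _
    have hV := psi_nat_eq (σ := σ) (b := b) hν hα
    have hInt : (∫ r in Ioi (0 : ℝ),
        (Real.exp (-α * r) ^ (k + 1) - 1 + (k + 1) * (1 - Real.exp (-α * r))) ∂ν) *
          n.descFactorial k =
        (∫ r in Ioi (0 : ℝ),
          (Real.exp (-α * r) ^ (n + 1) - 1 + (n + 1) * (1 - Real.exp (-α * r))) ∂ν) / (n + 1) *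
          ((k + 1) * n.descFactorial k) +
        ∑ j ∈ Finset.range n, (∫ r in Ioi (0 : ℝ), ((n + 1).choose j * Real.exp (-α * r) ^ j *
          (1 - Real.exp (-α * r)) ^ (n + 1 - j) / (n + 1)) ∂ν) *
          ((j.descFactorial (k + 1) : ℝ) - n.descFactorial (k + 1)) := by
      simp_rw [← integral_mul_const, ← integral_div, ← integral_mul_const]
      rw [← integral_finsetSum _ hWint, ← integral_add (((hV n).1.div_const _).mul_const _)
        (integrable_finsetSum _ hWint)]
      exact integral_congr_ae (Eventually.of_forall fun r =>
        pow_sub_mul_descFactorial_eq (Real.exp (-α * r)) n k)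
    rw [(hV k).2, (hV n).2]
    have hsum : ∀ x y d : ℕ → ℝ, ∑ j ∈ Finset.range n, (σ / 2 * α ^ 2 * x j + y j) * d j =
        σ / 2 * α ^ 2 * ∑ j ∈ Finset.range n, x j * d j + ∑ j ∈ Finset.range n, y j * d j := by
      intro x y d
      rw [Finset.mul_sum, ← Finset.sum_add_distrib]
      exact Finset.sum_congr rfl fun j _ => by ring
    rw [hsum]
    have hn : (n : ℝ) + 1 ≠ 0 := by positivity
    have hd := mul_descFactorial_eq n k
    rw [add_div, add_div, mul_div_cancel_left₀ _ hn,
      show σ / 2 * α ^ 2 * (((n : ℝ) + 1) * n) / (n + 1) = σ / 2 * α ^ 2 * n by field_simp]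
    linear_combination σ / 2 * α ^ 2 * hd + hInt

end Levy

section Positivity

variable {σ b : ℝ} {ν : Measure ℝ}

lemma setIntegral_pos_of_forall_pos {s : Set ℝ} {f : ℝ → ℝ} (hs : MeasurableSet s)
    (hf : IntegrableOn f s ν) (hpos : ∀ x ∈ s, 0 < f x) (hν : ν s ≠ 0) : 0 < ∫ x in s, f x ∂ν := by
  have h0 : 0 ≤ᵐ[ν.restrict s] f := by
    filter_upwards [ae_restrict_mem hs] with x hx using (hpos x hx).le
  rw [setIntegral_pos_iff_support_of_nonneg_ae h0 hf,
    inter_eq_self_of_subset_right (t := s) (s := Function.support f) fun x hx => (hpos x hx).ne']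
  exact pos_iff_ne_zero.2 hν

lemma psi_eq_of_integrableOn
    (hν : ∫⁻ r in Ioi (0 : ℝ), ENNReal.ofReal (min 1 (r ^ 2)) ∂ν < ⊤)
    (h1 : IntegrableOn (fun r => r) (Ioi 1) ν) {u : ℝ} (hu : 0 ≤ u) :
    IntegrableOn (fun r => Real.exp (-u * r) - 1 + u * r) (Ioi 0) ν ∧
    psi σ b ν u = (b - ∫ r in Ioi (1 : ℝ), r ∂ν) * u + σ / 2 * u ^ 2 +
      ∫ r in Ioi (0 : ℝ), (Real.exp (-u * r) - 1 + u * r) ∂ν := by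
  have hf := integrableOn_psi_integrand hν hu
  have hi : IntegrableOn ((Ioi (1 : ℝ)).indicator fun r => r) (Ioi 0) ν :=
    ((integrable_indicator_iff measurableSet_Ioi).2 h1).integrableOn
  have e : (fun r => Real.exp (-u * r) - 1 + u * r) = fun r =>
      (Real.exp (-u * r) - 1 + (if r ≤ 1 then u * r else 0)) +
        u * (Ioi (1 : ℝ)).indicator (fun r => r) r := by
    ext r
    by_cases h : r ≤ 1
    · simp [h]
    · simp [h, not_le.1 h]
  rw [e]
  refine ⟨hf.add (hi.const_mul u), ?_⟩
  rw [integral_add hf (hi.const_mul u), integral_const_mul,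
    setIntegral_indicator measurableSet_Ioi,
    inter_eq_self_of_subset_right (Ioi_subset_Ioi zero_le_one), psi]
  ring

lemma psi_pos_of_drift_nonneg (hσ : 0 ≤ σ)
    (hν : ∫⁻ r in Ioi (0 : ℝ), ENNReal.ofReal (min 1 (r ^ 2)) ∂ν < ⊤)
    (hnd : 0 < σ ∨ ν (Ioi 0) ≠ 0 ∨ b ≠ 0) (h1 : IntegrableOn (fun r => r) (Ioi 1) ν)
    (hm : 0 ≤ b - ∫ r in Ioi (1 : ℝ), r ∂ν) {u : ℝ} (hu : 0 < u) : 0 < psi σ b ν u := by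
  obtain ⟨hInt, heq⟩ := psi_eq_of_integrableOn (σ := σ) (b := b) hν h1 hu.le
  have hpos : ∀ r ∈ Ioi (0 : ℝ), 0 < Real.exp (-u * r) - 1 + u * r := by
    intro r hr
    have hr : 0 < r := hr
    have := Real.add_one_lt_exp (x := -u * r) (by
      have := mul_pos hu hr
      linarith)
    linarith
  have h2 : 0 ≤ (b - ∫ r in Ioi (1 : ℝ), r ∂ν) * u := by positivity
  have h3 : 0 ≤ ∫ r in Ioi (0 : ℝ), (Real.exp (-u * r) - 1 + u * r) ∂ν :=
    setIntegral_nonneg measurableSet_Ioi fun r hr => (hpos r hr).le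
  have h4 : 0 ≤ σ / 2 * u ^ 2 := by positivity
  rw [heq]
  by_cases hν0 : ν (Ioi 0) = 0
  · rcases hnd with h | h | h
    · have : 0 < σ / 2 * u ^ 2 := by positivity
      linarith
    · exact absurd hν0 h
    · have hz : ν.restrict (Ioi 1) = 0 :=
        Measure.restrict_eq_zero.2 (measure_mono_null (Ioi_subset_Ioi zero_le_one) hν0)
      rw [hz, integral_zero_measure, sub_zero] at hm h2 ⊢
      have : 0 < b * u := mul_pos (lt_of_le_of_ne hm h.symm) hu
      linarith
  · have := setIntegral_pos_of_forall_pos measurableSet_Ioi hInt hpos hν0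
    linarith

lemma psi_pos_of_root_lt (hσ : 0 ≤ σ)
    (hν : ∫⁻ r in Ioi (0 : ℝ), ENNReal.ofReal (min 1 (r ^ 2)) ∂ν < ⊤)
    (hnd : 0 < σ ∨ ν (Ioi 0) ≠ 0 ∨ b ≠ 0) {θ u : ℝ} (hθ : 0 < θ) (h0 : psi σ b ν θ = 0)
    (hu : θ < u) : 0 < psi σ b ν u := by
  have hu0 : 0 < u := hθ.trans hu
  obtain ⟨hInt, heq⟩ := psi_sub_mul_psi (σ := σ) (b := b) hν hu0.le hθ.le (u / θ)
    (by field_simp)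
  have hpos : ∀ r ∈ Ioi (0 : ℝ),
      0 < Real.exp (-u * r) - 1 - u / θ * (Real.exp (-θ * r) - 1) := by
    intro r hr
    have hr : 0 < r := hr
    have h1 : Real.exp (-θ * r) < 1 := by
      rw [Real.exp_lt_one_iff]
      have := mul_pos hθ hr
      linarith
    have h2 := one_add_mul_self_lt_rpow_one_add (s := Real.exp (-θ * r) - 1)
      (by have := Real.exp_pos (-θ * r); linarith) (by linarith) ((one_lt_div hθ).2 hu)
    rw [add_sub_cancel, ← Real.exp_mul,
      show -θ * r * (u / θ) = -u * r by field_simp] at h2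
    linarith
  have h3 : 0 ≤ ∫ r in Ioi (0 : ℝ),
      (Real.exp (-u * r) - 1 - u / θ * (Real.exp (-θ * r) - 1)) ∂ν :=
    setIntegral_nonneg measurableSet_Ioi fun r hr => (hpos r hr).le
  have h5 : 0 < u ^ 2 - u * θ := by nlinarith
  rw [heq, h0, mul_zero, zero_add]
  by_cases hν0 : ν (Ioi 0) = 0
  · rcases hσ.eq_or_lt with rfl | hσ
    · have hb : b ≠ 0 := by
        rcases hnd with h | h | h
        · exact absurd h (lt_irrefl _)
        · exact absurd hν0 h
        · exact h
      rw [psi, Measure.restrict_eq_zero.2 hν0] at h0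
      simp [hb, hθ.ne'] at h0
    · have : 0 < σ / 2 * (u ^ 2 - u * θ) := by positivity
      linarith
  · have := setIntegral_pos_of_forall_pos measurableSet_Ioi hInt hpos hν0
    have : 0 ≤ σ / 2 * (u ^ 2 - u * θ) := by positivity
    linarith

end Positivity

section Coefficients

variable {ψ : ℝ → ℝ} {α c : ℝ}

lemma coeffA_zero : coeffA ψ α 0 = 1 := by simp [coeffA]

lemma coeffA_succ (n : ℕ) : coeffA ψ α (n + 1) = coeffA ψ α n * (ψ (α * (n + 1)))⁻¹ := by
  rw [coeffA, Finset.prod_range_succ, mul_inv, coeffA]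

lemma coeffA_pos (hψ : ∀ n : ℕ, 0 < ψ (α * (n + 1))) (n : ℕ) : 0 < coeffA ψ α n :=
  inv_pos.2 (Finset.prod_pos fun k _ => hψ k)

lemma coeffA_le (hc : 0 < c) (hψ : ∀ n : ℕ, (n + 1) * c ≤ ψ (α * (n + 1))) (n : ℕ) :
    coeffA ψ α n ≤ c⁻¹ ^ n / n.factorial := by
  induction n with
  | zero => simp [coeffA]
  | succ n ih =>
    rw [coeffA_succ]
    have h1 : (0 : ℝ) < (n + 1) * c := by positivity
    calc coeffA ψ α n * (ψ (α * (n + 1)))⁻¹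
        ≤ c⁻¹ ^ n / n.factorial * ((n + 1) * c)⁻¹ :=
          mul_le_mul ih (inv_anti₀ h1 (hψ n)) (inv_nonneg.2 (h1.le.trans (hψ n))) (by positivity)
      _ = _ := by
          rw [Nat.factorial_succ, pow_succ]
          push_cast
          field_simp

lemma summable_coeffA_mul_pow (hc : 0 < c) (hψ : ∀ n : ℕ, (n + 1) * c ≤ ψ (α * (n + 1)))
    (x : ℝ) (hx : 0 ≤ x) : Summable fun k => coeffA ψ α k * x ^ k := by
  have ha : ∀ n, 0 < coeffA ψ α n := coeffA_pos fun n => lt_of_lt_of_le (by positivity) (hψ n)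
  refine Summable.of_nonneg_of_le (fun k => by have := ha k; positivity) (fun k => ?_)
    (Real.summable_pow_div_factorial (c⁻¹ * x))
  calc _ ≤ c⁻¹ ^ k / k.factorial * x ^ k :=
        mul_le_mul_of_nonneg_right (coeffA_le hc hψ k) (by positivity)
    _ = _ := by rw [mul_pow]; ring

lemma summable_mul_coeffA_mul_pow (hc : 0 < c)
    (hψ : ∀ n : ℕ, (n + 1) * c ≤ ψ (α * (n + 1))) (x : ℝ) (hx : 0 ≤ x) :
    Summable fun k : ℕ => k * coeffA ψ α k * x ^ k := by
  have ha : ∀ n, 0 < coeffA ψ α n := coeffA_pos fun n => lt_of_lt_of_le (by positivity) (hψ n)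
  refine Summable.of_nonneg_of_le (fun k => by have := ha k; positivity) (fun k => ?_)
    (summable_coeffA_mul_pow hc hψ (2 * x) (by positivity))
  have h1 : (k : ℝ) ≤ 2 ^ k := by exact_mod_cast Nat.lt_two_pow_self.le
  have h2 : 0 ≤ coeffA ψ α k * x ^ k := by have := ha k; positivity
  calc _ = k * (coeffA ψ α k * x ^ k) := by ring
    _ ≤ 2 ^ k * (coeffA ψ α k * x ^ k) := mul_le_mul_of_nonneg_right h1 h2
    _ = _ := by rw [mul_pow]; ring

lemma mul_deriv_Iser (hc : 0 < c) (hψ : ∀ n : ℕ, (n + 1) * c ≤ ψ (α * (n + 1)))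
    {q : ℝ} (hq : 0 ≤ q) :
    q * deriv (Iser ψ α) q = ∑' k : ℕ, k * coeffA ψ α k * q ^ k := by
  have ha : ∀ n, 0 < coeffA ψ α n := coeffA_pos fun n => lt_of_lt_of_le (by positivity) (hψ n)
  have hq1 : 1 ≤ q + 1 := by linarith
  have hd : HasDerivAt (fun z => ∑' k : ℕ, coeffA ψ α k * z ^ k)
      (∑' k : ℕ, coeffA ψ α k * (k * q ^ (k - 1))) q := by
    refine hasDerivAt_tsum_of_isPreconnected
      (summable_mul_coeffA_mul_pow hc hψ (q + 1) (by positivity))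
      Metric.isOpen_ball (convex_ball (0 : ℝ) (q + 1)).isPreconnected
      (fun n y _ => (hasDerivAt_pow n y).const_mul _) (fun n y hy => ?_)
      (Metric.mem_ball_self (by positivity)) (summable_coeffA_mul_pow hc hψ 0 le_rfl) ?_
    · have hy : |y| ≤ q + 1 := by simpa using (mem_ball_zero_iff.1 hy).le
      rw [norm_mul, norm_mul, Real.norm_of_nonneg (ha n).le, Real.norm_natCast, norm_pow,
        Real.norm_eq_abs]
      have h1 : |y| ^ (n - 1) ≤ (q + 1) ^ n :=
        (pow_le_pow_left₀ (abs_nonneg y) hy _).trans (pow_le_pow_right₀ hq1 (Nat.sub_le n 1))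
      calc _ = n * coeffA ψ α n * |y| ^ (n - 1) := by ring
        _ ≤ _ := mul_le_mul_of_nonneg_left h1 (by have := ha n; positivity)
    · rw [mem_ball_zero_iff, Real.norm_of_nonneg hq]; linarith
  have hI : Iser ψ α = fun z => ∑' k : ℕ, coeffA ψ α k * z ^ k := rfl
  rw [hI, hd.deriv, ← tsum_mul_left]
  refine tsum_congr fun k => ?_
  rcases k with _ | k
  · simp
  · rw [Nat.add_sub_cancel, pow_succ]; ring

lemma one_le_Iser (hc : 0 < c) (hψ : ∀ n : ℕ, (n + 1) * c ≤ ψ (α * (n + 1)))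
    {q : ℝ} (hq : 0 ≤ q) : 1 ≤ Iser ψ α q := by
  have ha : ∀ n, 0 < coeffA ψ α n := coeffA_pos fun n => lt_of_lt_of_le (by positivity) (hψ n)
  have := (summable_coeffA_mul_pow hc hψ q hq).le_tsum 0
    (fun k _ => by have := ha k; positivity)
  simpa [coeffA_zero, Iser] using this

end Coefficients

/-- Theorem 2.4, second mapping of (2.4): `q ↦ (1/I_{α,ψ}(q)) exp(-q I'_{α,ψ}(q)/I_{α,ψ}(q))`
is the Laplace transform of an infinitely divisible probability distribution on `[0,∞)`. -/
theorem Ifun_second_mapping_infinitely_divisible (σ b : ℝ) (ν : Measure ℝ)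
    (hσ : 0 ≤ σ)
    (hν : ∫⁻ r in Ioi (0 : ℝ), ENNReal.ofReal (min 1 (r ^ 2)) ∂ν < ⊤)
    (hnd : 0 < σ ∨ ν (Ioi 0) ≠ 0 ∨ b ≠ 0)
    (hns : 0 < σ ∨ ¬ IntegrableOn (fun r => r) (Ioc 0 1) ν ∨
      0 < b - ∫ r in Ioc (0 : ℝ) 1, r ∂ν)
    (α : ℝ) (hα : 0 < α)
    (hcase : (IntegrableOn (fun r => r) (Ioi 1) ν ∧ 0 ≤ b - ∫ r in Ioi (1 : ℝ), r ∂ν) ∨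
      ((¬ IntegrableOn (fun r => r) (Ioi 1) ν ∨ b - ∫ r in Ioi (1 : ℝ), r ∂ν < 0) ∧
        ∃ θ : ℝ, 0 < θ ∧ psi σ b ν θ = 0 ∧ θ < α)) :
    ∃ a : ℝ, 0 ≤ a ∧ ∃ μ : Measure ℝ,
      (∫⁻ r in Ioi (0 : ℝ), ENNReal.ofReal (min 1 r) ∂μ < ⊤) ∧
      ∀ q : ℝ, 0 ≤ q →
        (1 / Iser (psi σ b ν) α q) *
            Real.exp (-(q * deriv (Iser (psi σ b ν) α) q / Iser (psi σ b ν) α q)) =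
          Real.exp (-(a * q + ∫ r in Ioi (0 : ℝ), (1 - Real.exp (-q * r)) ∂μ)) := by
  have hψ1 : 0 < psi σ b ν α := by
    rcases hcase with ⟨h1, hm⟩ | ⟨-, θ, hθ, h0, hlt⟩
    · exact psi_pos_of_drift_nonneg hσ hν hnd h1 hm hα
    · exact psi_pos_of_root_lt hσ hν hnd hθ h0 hlt
  have hψ := mul_psi_le_psi_nat (b := b) hσ hν hα
  have hp : ∀ n : ℕ, 0 < psi σ b ν (α * (n + 1)) := fun n =>
    lt_of_lt_of_le (by positivity) (hψ n)
  have ha := coeffA_pos hp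
  obtain ⟨ℓ, hℓ, hchain⟩ := exists_skipFree_rates (b := b) hσ hν hα
  have hs0 := summable_coeffA_mul_pow hψ1 hψ
  have hs1 := summable_mul_coeffA_mul_pow hψ1 hψ
  have hB := isBern_log_add_logDeriv (p := fun k => psi σ b ν (α * k)) coeffA_zero ha
    (fun n => by
      have := hp n
      rw [coeffA_succ]
      push_cast
      field_simp)
    (fun n => by simpa using hp n) hℓ (fun n k => by simpa using hchain n k) hs0 hs1
  obtain ⟨a, ha0, μ, hμ, hF⟩ :=
    hB.exists_levy_measure (tendsto_log_add_logDeriv coeffA_zero ha hs0 hs1)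
  refine ⟨a, ha0, μ, hμ, fun q hq => ?_⟩
  lift q to NNReal using hq
  have hI : 0 < Iser (psi σ b ν) α q := zero_lt_one.trans_le (one_le_Iser hψ1 hψ q.coe_nonneg)
  rw [← hF q, mul_deriv_Iser hψ1 hψ q.coe_nonneg, neg_add, Real.exp_add, Real.exp_neg (Real.log _),
    ← Iser, Real.exp_log hI, one_div]
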